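/- Let p be an odd prime and K a finite field extension of ℚ_p. Let s ≥ 1 and let e : Fin s → ℕ satisfy e(i) ≥ 1 for all i; set a = #{i : e(i) = 1}, b = #{i : e(i) = 2}, c = #{i : e(i) ≥ 3}, and n = Σ_i e(i). Let Q₀ be an anisotropic quadratic form of degree d over K and assume n ≥ d and n ≡ d (mod 2). Let N be the number of s-tuples (c₁,…,c_s), where each c_i is an isometry class of nondegenerate quadratic forms of degree e(i) over K, such that the orthogonal sum of representatives of the c_i is Witt equivalent to Q₀. Then, as integers: if c ≥ 1, 8N = 4^a·7^b·8^c; if c = 0 and a > 0, 8N = 4^a·7^b + (2−d)·2^{a+1}; and if a = c = 0, then N = (7^b − (−1)^b)/8 + ε, where ε = 1 if d = 0 and b is even, ε = −1 if d = 4 and b is odd, and ε = 0 otherwise. -/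

import Mathlib

/-- A quadratic form of degree `m` over `K`: a quadratic form on `Fin m → K`. -/
abbrev QF (K : Type) [Field K] (m : ℕ) : Type := QuadraticForm K (Fin m → K)

/-- Two quadratic forms are isometric if there is a linear equivalence of the underlying
spaces carrying one to the other. -/
def QIsom {K : Type} [Field K] {M M' : Type} [AddCommGroup M] [Module K M]
    [AddCommGroup M'] [Module K M'] (Q : QuadraticForm K M) (Q' : QuadraticForm K M') : Prop :=
  ∃ φ : M ≃ₗ[K] M', ∀ x, Q' (φ x) = Q x

/-- The hyperbolic plane `(x, y) ↦ x * y` on `K²`. -/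
noncomputable def HypForm (K : Type) [Field K] : QuadraticForm K (K × K) :=
  QuadraticMap.linMulLin (LinearMap.fst K K K) (LinearMap.snd K K K)

/-- Orthogonal sum of `m` copies of the hyperbolic plane. -/
noncomputable def HypSum (K : Type) [Field K] (m : ℕ) : QuadraticForm K (Fin m → K × K) :=
  QuadraticMap.pi (fun _ : Fin m => HypForm K)

/-- Witt equivalence of quadratic forms. -/
def WittEquiv {K : Type} [Field K] {M M' : Type} [AddCommGroup M] [Module K M]
    [AddCommGroup M'] [Module K M'] (Q : QuadraticForm K M) (Q' : QuadraticForm K M') : Prop :=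
  ∃ a b : ℕ, QIsom (Q.prod (HypSum K a)) (Q'.prod (HypSum K b))

/-- A quadratic form is nondegenerate if its polar bilinear form is nondegenerate. -/
def QNondeg {K : Type} [Field K] {M : Type} [AddCommGroup M] [Module K M]
    (Q : QuadraticForm K M) : Prop :=
  ∀ v, (∀ w, QuadraticMap.polar (⇑Q) v w = 0) → v = 0

/-- The diagonal quadratic form `⟨a₁, …, a_m⟩`. -/
noncomputable def diagQF {K : Type} [Field K] {m : ℕ} (r : Fin m → Kˣ) : QF K m :=
  QuadraticMap.weightedSumSquares K (fun i => (r i : K))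

/-- The Lie algebra `so(Q)`. -/
def soSet {K : Type} [Field K] {M : Type} [AddCommGroup M] [Module K M]
    (Q : QuadraticForm K M) : Set (Module.End K M) :=
  {X | ∀ v w, QuadraticMap.polar (⇑Q) (X v) w + QuadraticMap.polar (⇑Q) v (X w) = 0}

/-- Membership in the orthogonal group `O(Q)` (as invertible linear maps preserving `Q`). -/
def InO {K : Type} [Field K] {M : Type} [AddCommGroup M] [Module K M]
    (Q : QuadraticForm K M) (g : M ≃ₗ[K] M) : Prop :=
  ∀ v, Q (g v) = Q v

/-- Membership in the special orthogonal group `SO(Q)`. -/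
def InSO {K : Type} [Field K] {M : Type} [AddCommGroup M] [Module K M]
    (Q : QuadraticForm K M) (g : M ≃ₗ[K] M) : Prop :=
  InO Q g ∧ LinearMap.det (g : M →ₗ[K] M) = 1

/-- A nilpotent endomorphism has Jordan type `λ` when `dim ker (X^i) = Σ_j min(i, λ_j)`. -/
def HasJordanType {K : Type} [Field K] {M : Type} [AddCommGroup M] [Module K M]
    {n : ℕ} (X : Module.End K M) (lam : Nat.Partition n) : Prop :=
  ∀ i : ℕ, Module.finrank K (LinearMap.ker (X ^ i)) = (lam.parts.map (fun part => min i part)).sum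

/-- `Λ(n)`: partitions of `n` in which every even part has even multiplicity. -/
def LambdaSet (n : ℕ) : Set (Nat.Partition n) :=
  {lam | ∀ j : ℕ, Even j → Even (lam.parts.count j)}




open scoped Pointwise Valued NormedField in
open Valued.integer in
theorem local_structure (p : ℕ) [Fact p.Prime] (K : Type) [Field K]
    [Algebra ℚ_[p] K] [FiniteDimensional ℚ_[p] K] :
    ∃ (O : Type) (_ : CommRing O) (_ : IsDomain O) (_ : IsDiscreteValuationRing O)
      (_ : Algebra O K), IsFractionRing O K ∧ HenselianRing O (IsLocalRing.maximalIdeal O) ∧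
      Finite (IsLocalRing.ResidueField O) ∧ ¬ IsUnit (p : O) := by
  let : NontriviallyNormedField K := spectralNorm.nontriviallyNormedField ℚ_[p] K
  let : NormedAlgebra ℚ_[p] K := spectralNorm.normedAlgebra ℚ_[p] K
  have : IsUltrametricDist K := IsUltrametricDist.isUltrametricDist_of_forall_norm_add_le_max_norm
    (fun x y => isNonarchimedean_spectralNorm (K := ℚ_[p]) x y)
  have : ProperSpace K := FiniteDimensional.proper ℚ_[p] K
  have : CompactSpace 𝒪[K] := by
    refine isCompact_iff_compactSpace.mp (?_ : IsCompact ((𝒪[K] : Subring K) : Set K))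
    convert isCompact_closedBall (0:K) 1 using 1
    ext x
    simpa using mem_iff
  have : (Valued.v : Valuation K _).IsNontrivial :=
    (inferInstance : (NormedField.valuation (K := K)).RankOne).toIsNontrivial
  have : IsDiscreteValuationRing 𝒪[K] := isDiscreteValuationRing_of_compactSpace
  have hfin : Finite 𝓀[K] :=
    ((@compactSpace_iff_completeSpace_and_isDiscreteValuationRing_and_finite_residueField K _ _ _ _
      (inferInstance : (NormedField.valuation (K := K)).RankOne)).mp ‹_›).2.2
  have : IsAdicComplete 𝓂[K] 𝒪[K] := 
    { prec' := by
        intro f hf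
        let S n : Set 𝒪[K] := f n +ᵥ ((𝓂[K] ^ n : Ideal 𝒪[K]) : Set 𝒪[K])
        have hS n : S (n + 1) ⊆ S n := by
          apply (Set.vadd_set_subset_vadd_set_iff.mpr (Ideal.pow_le_pow_right n.le_succ)).trans
          simpa [S] using (hf n.le_succ).symm
        have h n : IsClosed (S n) := (IsNoetherianRing.isClosed_ideal (𝓂[K] ^ n)).vadd (f n)
        obtain ⟨L, hL⟩ := (h 0).isCompact.nonempty_iInter_of_sequence_nonempty_isCompact_isClosed S hS
          (by simp [S]) h
        refine ⟨L, fun n ↦ ?_⟩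
        obtain ⟨y, hy, rfl⟩ := Set.mem_iInter.mp hL n
        simpa [SModEq.sub_mem] using hy }
  refine ⟨𝒪[K], inferInstance, inferInstance, inferInstance, inferInstance, inferInstance, inferInstance, inferInstance, ?_⟩
  rw [isUnit_iff_norm_eq_one]
  have : ‖((p : 𝒪[K]) : K)‖ = ‖(p : ℚ_[p])‖ := by
    rw [← norm_algebraMap' K (p : ℚ_[p])]; simp
  have h2 := (Padic.norm_p_lt_one (p := p))
  intro h3
  have : ‖(p : 𝒪[K])‖ = ‖((p : 𝒪[K]) : K)‖ := rfl
  linarith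


theorem ff_nonsq {k : Type*} [Field k] [Finite k] (h2 : (2:k) ≠ 0) {a b : k}
    (ha : ¬ IsSquare a) (hb : ¬ IsSquare b) : IsSquare (a * b) := by
  have := Fintype.ofFinite k
  have hF : ringChar k ≠ 2 := by
    intro h; apply h2
    have := ringChar.spec k 2
    rw [h] at this
    exact_mod_cast this.2 dvd_rfl
  have ha0 : a ≠ 0 := by rintro rfl; exact ha (IsSquare.zero)
  have hb0 : b ≠ 0 := by rintro rfl; exact hb (IsSquare.zero)
  rw [FiniteField.isSquare_iff hF ha0] at ha
  rw [FiniteField.isSquare_iff hF hb0] at hb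
  rw [FiniteField.isSquare_iff hF (mul_ne_zero ha0 hb0), mul_pow]
  rw [(FiniteField.pow_dichotomy hF ha0).resolve_left ha, (FiniteField.pow_dichotomy hF hb0).resolve_left hb]
  norm_num

theorem ff_sum2 (k : Type*) [Field k] [Finite k] :
    ∃ a b : k, a ^ 2 + b ^ 2 = -1 := by
  have := Fintype.ofFinite k
  obtain ⟨p, hp⟩ := CharP.exists k
  have : Fact p.Prime := ⟨CharP.char_is_prime k p⟩
  obtain ⟨a, b, h⟩ := ZMod.sq_add_sq p (-1)
  let f := ZMod.castHom (dvd_refl p) k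
  exact ⟨f a, f b, by rw [← map_pow, ← map_pow, ← map_add, h]; simp⟩

open IsLocalRing in
theorem dvr_sq {O : Type} [CommRing O] [IsDomain O] [IsDiscreteValuationRing O] [HenselianRing O (maximalIdeal O)]
    (h2 : (2 : ResidueField O) ≠ 0) {x : O} (hx : residue O x ≠ 0)
    (h : IsSquare (residue O x)) : ∃ y, y ^ 2 = x := by
  obtain ⟨a, ha⟩ := h
  obtain ⟨a, rfl⟩ := residue_surjective a
  have := HenselianRing.is_henselian (I := maximalIdeal O) (Polynomial.X ^ 2 - Polynomial.C x)
    (Polynomial.monic_X_pow_sub_C _ (by norm_num)) a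
    (by rw [← residue_eq_zero_iff]; simp [ha]; ring)
    (by
      change IsUnit (residue O _)
      rw [isUnit_iff_ne_zero]
      have h1 : residue O a ≠ 0 := by
        intro h; rw [h] at ha; exact hx (by rw [ha]; ring)
      have h3 : residue O (2 * a) ≠ 0 := by
        rw [map_mul, map_ofNat]; exact mul_ne_zero h2 h1
      simpa [one_add_one_eq_two, -residue_eq_zero_iff] using h3)
  obtain ⟨y, hy, -⟩ := this
  refine ⟨y, ?_⟩
  simpa [Polynomial.IsRoot, sub_eq_zero] using hy

open IsLocalRing in
theorem dvr_dich {O : Type} [CommRing O] [IsDomain O] [IsDiscreteValuationRing O]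
    [HenselianRing O (maximalIdeal O)] [Finite (ResidueField O)]
    (h2 : (2 : ResidueField O) ≠ 0) {x δ : O} (hx : residue O x ≠ 0)
    (h : ¬ IsSquare (residue O δ)) : ∃ y, x = y ^ 2 ∨ x = δ * y ^ 2 := by
  by_cases hs : IsSquare (residue O x)
  · obtain ⟨y, hy⟩ := dvr_sq h2 hx hs
    exact ⟨y, Or.inl hy.symm⟩
  have hδ : residue O δ ≠ 0 := by intro h'; rw [h'] at h; exact h IsSquare.zero
  have hu : IsUnit δ := by
    rwa [residue_ne_zero_iff_isUnit] at hδ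
  obtain ⟨y, hy⟩ := dvr_sq (x := x * δ) h2 (by simp [hx, hδ])
    (by rw [map_mul]; exact ff_nonsq h2 hs h)
  obtain ⟨v, rfl⟩ := hu
  refine ⟨y * (v⁻¹ : Oˣ), Or.inr ?_⟩
  rw [mul_pow, hy]
  linear_combination (x * (-1 - (v:O) * (v⁻¹:Oˣ))) * (Units.mul_inv v)

open IsLocalRing in
theorem dvr_norm {O : Type} [CommRing O] [IsDomain O] [IsDiscreteValuationRing O]
    {ϖ δ x y : O} (hϖ : Irreducible ϖ) (h : ¬ IsSquare (residue O δ))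
    (hd : ϖ ∣ x ^ 2 - δ * y ^ 2) : ϖ ∣ x ∧ ϖ ∣ y := by
  have key : ∀ z : O, ϖ ∣ z ↔ residue O z = 0 := by
    intro z
    rw [residue_eq_zero_iff, hϖ.maximalIdeal_eq, Ideal.mem_span_singleton]
  simp only [key] at *
  have hy : residue O y = 0 := by
    by_contra hy
    apply h
    refine ⟨residue O x / residue O y, ?_⟩
    field_simp
    simp at hd
    linear_combination -hd
  rw [map_sub, map_mul, map_pow, map_pow, hy] at hd
  exact ⟨by simpa [-residue_eq_zero_iff] using hd, hy⟩

open IsLocalRing in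
theorem dvr_aniso {O : Type} [CommRing O] [IsDomain O] [IsDiscreteValuationRing O]
    {ϖ δ : O} (hϖ : Irreducible ϖ) (h : ¬ IsSquare (residue O δ)) (n : ℕ) :
    ∀ x y z w : O, x ^ 2 - δ * y ^ 2 + ϖ * (z ^ 2 - δ * w ^ 2) = 0 →
    ϖ ^ n ∣ x ∧ ϖ ^ n ∣ y ∧ ϖ ^ n ∣ z ∧ ϖ ^ n ∣ w := by
  induction n with
  | zero => simp
  | succ n ih =>
    intro x y z w h0
    obtain ⟨⟨x, rfl⟩, ⟨y, rfl⟩⟩ := dvr_norm (x := x) (y := y) hϖ h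
      ⟨-(z ^ 2 - δ * w ^ 2), by linear_combination h0⟩
    have h1 : ϖ * (x ^ 2 - δ * y ^ 2) + (z ^ 2 - δ * w ^ 2) = 0 := by
      apply mul_left_cancel₀ hϖ.ne_zero
      linear_combination h0
    obtain ⟨⟨z, rfl⟩, ⟨w, rfl⟩⟩ := dvr_norm (x := z) (y := w) hϖ h
      ⟨-(x ^ 2 - δ * y ^ 2), by linear_combination h1⟩
    have h2 : (x ^ 2 - δ * y ^ 2) + ϖ * (z ^ 2 - δ * w ^ 2) = 0 := by
      apply mul_left_cancel₀ hϖ.ne_zero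
      linear_combination h1
    obtain ⟨a, b, c, d⟩ := ih _ _ _ _ h2
    simp only [pow_succ']
    exact ⟨mul_dvd_mul_left _ a, mul_dvd_mul_left _ b, mul_dvd_mul_left _ c, mul_dvd_mul_left _ d⟩

open IsLocalRing in
theorem dvr_zero {O : Type} [CommRing O] [IsDomain O] [IsDiscreteValuationRing O]
    {ϖ x : O} (hϖ : Irreducible ϖ) (h : ∀ n, ϖ ^ n ∣ x) : x = 0 := by
  by_contra hx
  obtain ⟨n, v, rfl⟩ := IsDiscreteValuationRing.eq_unit_mul_pow_irreducible hx hϖ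
  have := h (n+1)
  rw [v.isUnit.dvd_mul_left] at this
  exact absurd ((pow_dvd_pow_iff hϖ.ne_zero hϖ.not_isUnit).mp this) (by omega)

open IsLocalRing in
theorem field_facts (p : ℕ) [Fact p.Prime] (hp : p ≠ 2) (K : Type) [Field K]
    [Algebra ℚ_[p] K] [FiniteDimensional ℚ_[p] K] :
    ∃ u t : K, (∀ x y z w, x ^ 2 + u * y ^ 2 + t * (z ^ 2 + u * w ^ 2) = 0 →
        x = 0 ∧ y = 0 ∧ z = 0 ∧ w = 0) ∧
      (∀ x, x ≠ 0 → ∃ y, y ≠ 0 ∧ (x = y ^ 2 ∨ x = -u * y ^ 2 ∨ x = t * y ^ 2 ∨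
        x = t * -u * y ^ 2)) ∧
      ((∃ i : K, i ^ 2 = -1) ∨ (u = 1 ∧ ∃ a b : K, a ^ 2 + b ^ 2 = -1)) := by
  obtain ⟨O, _, _, _, _, _, _, _, hpu⟩ := local_structure p K
  have h2 : (2 : ResidueField O) ≠ 0 := by
    have h : (p : ResidueField O) = 0 := by
      have : residue O (p : O) = 0 := by
        rw [residue_eq_zero_iff]; exact hpu
      simpa using this
    obtain ⟨k, hk⟩ := ((Fact.out : p.Prime).odd_of_ne_two hp)
    intro h'
    rw [hk] at h
    push_cast at h
    rw [h'] at h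
    simp at h
  have hF : ringChar (ResidueField O) ≠ 2 := by
    intro h; apply h2
    have := ringChar.spec (ResidueField O) 2
    rw [h] at this
    exact_mod_cast this.2 dvd_rfl
  obtain ⟨δ, hδ, hδ'⟩ : ∃ δ : O, ¬ IsSquare (residue O δ) ∧
      ((∃ i : O, i ^ 2 = -1) ∨ (δ = -1 ∧ ∃ a b : O, a ^ 2 + b ^ 2 = -1)) := by
    by_cases h : IsSquare (-1 : ResidueField O)
    · obtain ⟨a, ha⟩ := FiniteField.exists_nonsquare hF
      obtain ⟨a, rfl⟩ := residue_surjective a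
      refine ⟨a, ha, Or.inl ?_⟩
      exact dvr_sq (x := -1) h2 (by simp) (by simpa using h)
    · refine ⟨-1, by simpa using h, Or.inr ⟨rfl, ?_⟩⟩
      have main : ∀ a b : ResidueField O, a ≠ 0 → a ^ 2 + b ^ 2 = -1 →
          ∃ a b : O, a ^ 2 + b ^ 2 = -1 := by
        intro a b ha hab
        obtain ⟨b, rfl⟩ := residue_surjective b
        have e : residue O (-1 - b ^ 2) = a ^ 2 := by
          simp only [map_sub, map_neg, map_one, map_pow]
          linear_combination -hab
        obtain ⟨y, hy⟩ := dvr_sq (x := -1 - b ^ 2) h2 (by rw [e]; exact pow_ne_zero _ ha)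
          (by rw [e]; exact ⟨a, pow_two a⟩)
        exact ⟨y, b, by rw [hy]; ring⟩
      obtain ⟨a, b, hab⟩ := ff_sum2 (ResidueField O)
      by_cases ha : a = 0
      · refine main b a ?_ (by rw [← hab]; ring)
        rintro rfl
        rw [ha] at hab
        simp at hab
      · exact main a b ha hab
  obtain ⟨ϖ, hϖ⟩ := IsDiscreteValuationRing.exists_irreducible O
  let φ := algebraMap O K
  have hφ : Function.Injective φ := IsFractionRing.injective O K
  have hϖ0 : φ ϖ ≠ 0 := by
    rw [Ne, map_eq_zero_iff φ hφ]; exact hϖ.ne_zero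
  -- classes
  have hclsO : ∀ x : O, x ≠ 0 → ∃ y : K, y ≠ 0 ∧ (φ x = y ^ 2 ∨ φ x = φ δ * y ^ 2 ∨
      φ x = φ ϖ * y ^ 2 ∨ φ x = φ ϖ * φ δ * y ^ 2) := by
    intro x hx
    have hx0 : φ x ≠ 0 := by
      rw [Ne, map_eq_zero_iff φ hφ]; exact hx
    suffices ∃ y : K, (φ x = y ^ 2 ∨ φ x = φ δ * y ^ 2 ∨
      φ x = φ ϖ * y ^ 2 ∨ φ x = φ ϖ * φ δ * y ^ 2) by
      obtain ⟨y, hy⟩ := this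
      refine ⟨y, ?_, hy⟩
      rintro rfl
      simp at hy
      exact hx0 (by simpa using hy)
    obtain ⟨n, v, rfl⟩ := IsDiscreteValuationRing.eq_unit_mul_pow_irreducible hx hϖ
    obtain ⟨y, hy⟩ := dvr_dich (x := (v : O)) (δ := δ) h2
      (by rw [residue_ne_zero_iff_isUnit]; exact v.isUnit) hδ
    obtain ⟨m, rfl | rfl⟩ := Nat.even_or_odd' n
    · refine ⟨φ (y * ϖ ^ m), ?_⟩
      rcases hy with hy | hy <;> rw [hy]
      · left; simp only [← map_mul, ← map_pow]; congr 1; ring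
      · right; left; simp only [← map_mul, ← map_pow]; congr 1; ring
    · refine ⟨φ (y * ϖ ^ m), ?_⟩
      rcases hy with hy | hy <;> rw [hy]
      · right; right; left; simp only [← map_mul, ← map_pow]; congr 1; ring
      · right; right; right; simp only [← map_mul, ← map_pow]; congr 1; ring
  refine ⟨-φ δ, φ ϖ, ?_, ?_, ?_⟩
  · classical
    intro x y z w h
    obtain ⟨⟨s, hs⟩, hs'⟩ := IsLocalization.exist_integer_multiples_of_finset
      (nonZeroDivisors O) ({x, y, z, w} : Finset K)
    have hs0 : φ s ≠ 0 := by
      rw [Ne, map_eq_zero_iff φ hφ]; exact nonZeroDivisors.ne_zero hs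
    obtain ⟨x', hx⟩ := hs' x (by simp)
    obtain ⟨y', hy⟩ := hs' y (by simp)
    obtain ⟨z', hz⟩ := hs' z (by simp)
    obtain ⟨w', hw⟩ := hs' w (by simp)
    simp only [Algebra.smul_def] at hx hy hz hw
    have h0 : x' ^ 2 - δ * y' ^ 2 + ϖ * (z' ^ 2 - δ * w' ^ 2) = 0 := by
      apply hφ
      simp only [map_add, map_sub, map_mul, map_pow, map_zero]
      change (algebraMap O K x') ^ 2 - φ δ * (algebraMap O K y') ^ 2 +
        φ ϖ * ((algebraMap O K z') ^ 2 - φ δ * (algebraMap O K w') ^ 2) = 0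
      rw [hx, hy, hz, hw]
      linear_combination (algebraMap O K s) ^ 2 * h
    have hh := fun n => dvr_aniso hϖ hδ n _ _ _ _ h0
    have fin : ∀ a : K, ∀ a' : O, a' = 0 → algebraMap O K a' = algebraMap O K s * a → a = 0 := by
      rintro a a' rfl h
      rw [map_zero] at h
      exact (mul_eq_zero.mp h.symm).resolve_left hs0
    exact ⟨fin _ _ (dvr_zero hϖ fun n => (hh n).1) hx,
      fin _ _ (dvr_zero hϖ fun n => (hh n).2.1) hy,
      fin _ _ (dvr_zero hϖ fun n => (hh n).2.2.1) hz,
      fin _ _ (dvr_zero hϖ fun n => (hh n).2.2.2) hw⟩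
  · intro x hx
    simp only [neg_neg]
    obtain ⟨a, b, hb, rfl⟩ := IsFractionRing.div_surjective (A := O) x
    have hb0 : φ b ≠ 0 := by
      rw [Ne, map_eq_zero_iff φ hφ]; exact nonZeroDivisors.ne_zero hb
    have hab : a * b ≠ 0 := by
      apply mul_ne_zero _ (nonZeroDivisors.ne_zero hb)
      rintro rfl
      simp at hx
    obtain ⟨y, hy0, hy⟩ := hclsO _ hab
    refine ⟨y / φ b, div_ne_zero hy0 hb0, ?_⟩
    change φ a / φ b = _ ∨ φ a / φ b = _ ∨ φ a / φ b = _ ∨ φ a / φ b = _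
    rw [map_mul] at hy
    rcases hy with hy | hy | hy | hy
    · left; field_simp; linear_combination hy
    · right; left; field_simp; linear_combination hy
    · right; right; left; field_simp; linear_combination hy
    · right; right; right; field_simp; linear_combination hy
  · rcases hδ' with ⟨i, hi⟩ | ⟨rfl, a, b, hab⟩
    · exact Or.inl ⟨φ i, by rw [← map_pow, hi]; simp⟩
    · exact Or.inr ⟨by simp, φ a, φ b, by rw [← map_pow, ← map_pow, ← map_add, hab]; simp⟩

/-- Bundled finite-dimensional quadratic spaces. -/
structure QM (K : Type) [Field K] : Type 1 where
  carrier : Type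
  [acg : AddCommGroup carrier]
  [mod : Module K carrier]
  [fin : Module.Finite K carrier]
  form : QuadraticForm K carrier

attribute [instance] QM.acg QM.mod QM.fin

section basics
variable {K : Type} [Field K]
variable {M M' M'' N N' : Type} [AddCommGroup M] [Module K M] [AddCommGroup M'] [Module K M']
  [AddCommGroup M''] [Module K M''] [AddCommGroup N] [Module K N] [AddCommGroup N'] [Module K N']

theorem QIsom.refl (Q : QuadraticForm K M) : QIsom Q Q := ⟨LinearEquiv.refl K M, fun _ => rfl⟩

theorem QIsom.symm {Q : QuadraticForm K M} {Q' : QuadraticForm K M'} (h : QIsom Q Q') :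
    QIsom Q' Q := by
  obtain ⟨φ, h⟩ := h
  exact ⟨φ.symm, fun x => by rw [← h]; simp⟩

theorem QIsom.trans {Q : QuadraticForm K M} {Q' : QuadraticForm K M'} {Q'' : QuadraticForm K M''}
    (h : QIsom Q Q') (h' : QIsom Q' Q'') : QIsom Q Q'' := by
  obtain ⟨φ, h⟩ := h
  obtain ⟨ψ, h'⟩ := h'
  exact ⟨φ.trans ψ, fun x => by simp [h, h']⟩

theorem QIsom.prod {Q : QuadraticForm K M} {Q' : QuadraticForm K M'} {P : QuadraticForm K N}
    {P' : QuadraticForm K N'} (h : QIsom Q Q') (h' : QIsom P P') :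
    QIsom (QuadraticMap.prod Q P) (QuadraticMap.prod Q' P') := by
  obtain ⟨φ, h⟩ := h
  obtain ⟨ψ, h'⟩ := h'
  exact ⟨LinearEquiv.prodCongr φ ψ, fun x => by simp [h, h']⟩

theorem QIsom.aniso {Q : QuadraticForm K M} {Q' : QuadraticForm K M'} (h : QIsom Q Q')
    (hQ : Q.Anisotropic) : Q'.Anisotropic := by
  obtain ⟨φ, h⟩ := h.symm
  intro x hx
  have := hQ (φ x) (by rw [h, hx])
  simpa using this

theorem QIsom.nondeg {Q : QuadraticForm K M} {Q' : QuadraticForm K M'} (h : QIsom Q Q')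
    (hQ : QNondeg Q) : QNondeg Q' := by
  obtain ⟨φ, h⟩ := h.symm
  intro x hx
  have := hQ (φ x) (by
    intro w
    have h1 := hx (φ.symm w)
    simp only [QuadraticMap.polar] at h1 ⊢
    rw [← h1, ← h, ← h, ← h]
    simp)
  simpa using this
end basics

instance QM.setoid (K : Type) [Field K] : Setoid (QM K) where
  r X Y := QIsom X.form Y.form
  iseqv := ⟨fun X => QIsom.refl X.form, QIsom.symm, QIsom.trans⟩

/-- Isometry classes of quadratic spaces. -/
def IC (K : Type) [Field K] : Type 1 := Quotient (QM.setoid K)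

/-- The class of a quadratic form. -/
def cls {K : Type} [Field K] {M : Type} [AddCommGroup M] [Module K M] [Module.Finite K M]
    (Q : QuadraticForm K M) : IC K := Quotient.mk (QM.setoid K) ⟨M, Q⟩

instance icAdd (K : Type) [Field K] : Add (IC K) where
  add := Quotient.map₂ (fun X Y => ⟨X.carrier × Y.carrier, QuadraticMap.prod X.form Y.form⟩)
    (fun _ _ h _ _ h' => QIsom.prod h h')

instance icZero (K : Type) [Field K] : Zero (IC K) where
  zero := cls (0 : QuadraticForm K PUnit)

instance icMonoid (K : Type) [Field K] : AddCommMonoid (IC K) where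
  add_assoc := by
    rintro ⟨X⟩ ⟨Y⟩ ⟨Z⟩
    exact Quotient.sound ⟨LinearEquiv.prodAssoc K _ _ _, fun x => by simp [add_assoc]⟩
  zero_add := by
    rintro ⟨X⟩
    exact Quotient.sound ⟨LinearEquiv.uniqueProd, fun x => by simp⟩
  add_zero := by
    rintro ⟨X⟩
    exact Quotient.sound ⟨LinearEquiv.prodUnique, fun x => by simp⟩
  add_comm := by
    rintro ⟨X⟩ ⟨Y⟩
    exact Quotient.sound ⟨LinearEquiv.prodComm K _ _, fun x => by simp [add_comm]⟩
  nsmul := nsmulRec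

section classes
variable {K : Type} [Field K]
variable {M M' : Type} [AddCommGroup M] [Module K M] [Module.Finite K M]
  [AddCommGroup M'] [Module K M'] [Module.Finite K M']

theorem cls_eq {Q : QuadraticForm K M} {Q' : QuadraticForm K M'} :
    cls Q = cls Q' ↔ QIsom Q Q' := by
  unfold cls
  constructor
  · intro h; exact Quotient.exact h
  · intro h; exact Quotient.sound h

theorem cls_prod (Q : QuadraticForm K M) (Q' : QuadraticForm K M') :
    cls (QuadraticMap.prod Q Q') = cls Q + cls Q' := rfl

theorem cls_ind {P : IC K → Prop} (h : ∀ (M : Type) [AddCommGroup M] [Module K M]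
    [Module.Finite K M] (Q : QuadraticForm K M), P (cls Q)) (x : IC K) : P x := by
  obtain ⟨X⟩ := x
  exact h X.carrier X.form

theorem cls_zero [Subsingleton M] (Q : QuadraticForm K M) : cls Q = 0 := by
  refine cls_eq.mpr ⟨LinearEquiv.ofSubsingleton M PUnit, fun x => ?_⟩
  rw [Subsingleton.elim x 0]; simp

theorem cls_pi {s : ℕ} (V : Fin s → Type) [∀ i, AddCommGroup (V i)] [∀ i, Module K (V i)]
    [∀ i, Module.Finite K (V i)] (Q : ∀ i, QuadraticForm K (V i)) :
    cls (QuadraticMap.pi Q) = ∑ i, cls (Q i) := by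
  induction s with
  | zero => simp [cls_zero]
  | succ s ih =>
    rw [Fin.sum_univ_succ, ← ih, ← cls_prod, cls_eq]
    refine QIsom.symm ⟨Fin.consLinearEquiv K V, fun x => ?_⟩
    simp [Fin.sum_univ_succ]

/-- dimension -/
noncomputable def icdim : IC K →+ ℕ where
  toFun := Quotient.lift (fun X => Module.finrank K X.carrier)
    (by rintro X Y ⟨φ, -⟩; exact φ.finrank_eq)
  map_zero' := by
    exact Module.finrank_zero_of_subsingleton (R := K) (M := PUnit)
  map_add' := by
    rintro ⟨X⟩ ⟨Y⟩
    exact Module.finrank_prod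

theorem icdim_cls (Q : QuadraticForm K M) : icdim (cls Q) = Module.finrank K M := rfl

/-- `⟨a⟩` -/
noncomputable def sqf (a : K) : QuadraticForm K K := a • QuadraticMap.sq

theorem sqf_apply (a x : K) : sqf a x = a * (x * x) := by simp [sqf]

/-- class of `⟨a⟩` -/
noncomputable def qc (a : K) : IC K := cls (sqf a)

variable (K) in
/-- class of the hyperbolic plane -/
noncomputable def hc : IC K := cls (HypForm K)

theorem hyp_apply (x : K × K) : HypForm K x = x.1 * x.2 := by simp [HypForm]

theorem cls_hypSum (k : ℕ) : cls (HypSum K k) = k • hc K := by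
  unfold HypSum
  rw [cls_pi]
  simp [hc]

theorem icdim_qc (a : K) : icdim (qc a) = 1 := by
  rw [qc, icdim_cls]; simp

theorem icdim_hc : icdim (hc K) = 2 := by
  rw [hc, icdim_cls]; simp

theorem cls_wss {m : ℕ} (w : Fin m → K) :
    cls (QuadraticMap.weightedSumSquares K w) = ∑ i, qc (w i) := by
  unfold qc
  rw [← cls_pi, cls_eq]
  refine ⟨LinearEquiv.refl K _, fun x => ?_⟩
  simp [QuadraticMap.weightedSumSquares_apply, sqf_apply]

theorem qc_mul_sq (a y : K) (hy : y ≠ 0) : qc (a * y ^ 2) = qc a := by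
  unfold qc
  rw [cls_eq]
  refine ⟨LinearEquiv.smulOfNeZero K K y hy, fun x => ?_⟩
  simp [sqf_apply]; ring

theorem qc_add_neg (h2 : (2:K) ≠ 0) (a : K) (ha : a ≠ 0) : qc a + qc (-a) = hc K := by
  unfold qc hc
  rw [← cls_prod, cls_eq]
  refine ⟨LinearEquiv.ofLinearMap
    ((a • (LinearMap.fst K K K + LinearMap.snd K K K)).prod
      (LinearMap.fst K K K - LinearMap.snd K K K))
    (((2:K)⁻¹ • (a⁻¹ • LinearMap.fst K K K + LinearMap.snd K K K)).prod
      ((2:K)⁻¹ • (a⁻¹ • LinearMap.fst K K K - LinearMap.snd K K K))) ?_ ?_, fun x => ?_⟩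
  · apply LinearMap.ext; rintro ⟨x, y⟩
    simp; constructor <;> field_simp <;> ring
  · apply LinearMap.ext; rintro ⟨x, y⟩
    simp; constructor <;> field_simp <;> ring
  · simp [hyp_apply, sqf_apply]; ring

theorem qc_two (x y c : K) (h : x ^ 2 + y ^ 2 = -1) : qc c + qc c = qc (-c) + qc (-c) := by
  unfold qc
  rw [← cls_prod, ← cls_prod, cls_eq]
  refine ⟨LinearEquiv.ofLinearMap
    ((x • LinearMap.fst K K K - y • LinearMap.snd K K K).prod
      (y • LinearMap.fst K K K + x • LinearMap.snd K K K))
    ((-(x • LinearMap.fst K K K + y • LinearMap.snd K K K)).prod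
      (y • LinearMap.fst K K K - x • LinearMap.snd K K K)) ?_ ?_, fun v => ?_⟩
  · apply LinearMap.ext; rintro ⟨v, w⟩
    simp; constructor
    · linear_combination (-v) * h
    · linear_combination (-w) * h
  · apply LinearMap.ext; rintro ⟨v, w⟩
    simp; constructor
    · linear_combination (-v) * h
    · linear_combination (-w) * h
  · simp [sqf_apply]
    linear_combination (-c * (v.1^2+v.2^2)) * h

theorem witt_iff (Q : QuadraticForm K M) (Q' : QuadraticForm K M') :
    WittEquiv Q Q' ↔ ∃ a b : ℕ, cls Q + a • hc K = cls Q' + b • hc K := by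
  unfold WittEquiv
  simp only [← cls_hypSum, ← cls_prod, cls_eq]

/-- anisotropic class -/
def IsAn (x : IC K) : Prop := ∃ X : QM K, Quotient.mk (QM.setoid K) X = x ∧ X.form.Anisotropic

/-- nondegenerate class -/
def IsND (x : IC K) : Prop := ∃ X : QM K, Quotient.mk (QM.setoid K) X = x ∧ QNondeg X.form

theorem isAn_cls (Q : QuadraticForm K M) : IsAn (cls Q) ↔ Q.Anisotropic := by
  constructor
  · rintro ⟨X, h, hX⟩
    exact QIsom.aniso (Quotient.exact h) hX
  · intro h; exact ⟨⟨M, Q⟩, rfl, h⟩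

theorem isND_cls (Q : QuadraticForm K M) : IsND (cls Q) ↔ QNondeg Q := by
  constructor
  · rintro ⟨X, h, hX⟩
    exact QIsom.nondeg (Quotient.exact h) hX
  · intro h; exact ⟨⟨M, Q⟩, rfl, h⟩

theorem IsAn.left {x y : IC K} : IsAn (x + y) → IsAn x := by
  induction x using cls_ind with | _ M Q
  induction y using cls_ind with | _ N P
  rw [← cls_prod, isAn_cls, isAn_cls]
  intro h
  exact (QuadraticMap.anisotropic_of_prod h).1

theorem not_isAn_hc (x : IC K) : ¬ IsAn (x + hc K) := by
  rw [add_comm]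
  intro h
  have := h.left
  rw [hc, isAn_cls] at this
  have := this ((1:K), (0:K)) (by simp [hyp_apply])
  simp at this

theorem IsAn.nd (h2 : (2:K) ≠ 0) {x : IC K} : IsAn x → IsND x := by
  induction x using cls_ind with | _ M Q
  rw [isAn_cls, isND_cls]
  intro h v hv
  have := hv v
  rw [QuadraticMap.polar_self] at this
  apply h
  simpa [h2] using this

theorem IsND.add {x y : IC K} : IsND x → IsND y → IsND (x + y) := by
  induction x using cls_ind with | _ M Q
  induction y using cls_ind with | _ N P
  rw [← cls_prod, isND_cls, isND_cls, isND_cls]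
  rintro h h' ⟨v, w⟩ hv
  simp only [QuadraticMap.polar_prod] at hv
  refine Prod.ext (h v fun a => ?_) (h' w fun a => ?_)
  · simpa using hv (a, 0)
  · simpa using hv (0, a)

theorem isND_hc : IsND (hc K) := by
  rw [hc, isND_cls]
  rintro ⟨a, b⟩ h
  have h1 := h (1, 0)
  have h2 := h (0, 1)
  simp [QuadraticMap.polar, hyp_apply] at h1 h2
  ring_nf at h1 h2
  simp [h1, h2]

theorem isND_zero : IsND (0 : IC K) := by
  refine ⟨⟨PUnit, 0⟩, rfl, ?_⟩
  intro v _; rfl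

theorem isND_nsmul_hc (k : ℕ) : IsND (k • hc K) := by
  induction k with
  | zero => simpa using isND_zero
  | succ k ih => rw [succ_nsmul]; exact ih.add isND_hc

theorem IsND.exists_sum (h2 : (2:K) ≠ 0) {x : IC K} : IsND x →
    ∃ (m : ℕ) (w : Fin m → Kˣ), x = ∑ i, qc (w i : K) := by
  induction x using cls_ind with | _ M Q
  rw [isND_cls]
  intro h
  have : Invertible (2:K) := invertibleOfNonzero h2
  obtain ⟨w, hw⟩ := QuadraticForm.equivalent_weightedSumSquares_units_of_nondegenerate' Q (by
    intro v hv
    apply h v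
    intro w
    have := hv w
    rw [QuadraticMap.associated_apply] at this
    simpa [QuadraticMap.polar, h2] using this)
  refine ⟨_, w, ?_⟩
  rw [← cls_wss, cls_eq]
  obtain ⟨φ⟩ := hw
  refine ⟨φ.toLinearEquiv, fun x => ?_⟩
  have := φ.map_app x
  exact this

theorem full_an (u t : K) (h : ∀ x y z w : K, x ^ 2 + u * y ^ 2 + t * (z ^ 2 + u * w ^ 2) = 0 →
        x = 0 ∧ y = 0 ∧ z = 0 ∧ w = 0) : IsAn (qc 1 + qc u + (qc t + qc (t * u))) := by
  unfold qc
  rw [← cls_prod, ← cls_prod, ← cls_prod, isAn_cls]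
  rintro ⟨⟨x, y⟩, ⟨z, w⟩⟩ h0
  simp [sqf_apply] at h0
  obtain ⟨rfl, rfl, rfl, rfl⟩ := h x y z w (by linear_combination h0)
  rfl

theorem exists_rep (x : IC K) (m : ℕ) (h : icdim x = m) : ∃ Q : QF K m, cls Q = x := by
  induction x using cls_ind with | _ M Q
  rw [icdim_cls] at h
  subst h
  let b := Module.finBasis K M
  refine ⟨Q.comp b.equivFun.symm.toLinearMap, ?_⟩
  rw [cls_eq]
  exact ⟨b.equivFun.symm, fun x => rfl⟩

theorem hyp_iso {a b : ℕ} {x : IC K} (h2 : (2 : K) ≠ 0) : IsAn x → x + a • hc K = b • hc K →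
    icdim x = 0 := by
  induction x using cls_ind with | _ M Q
  rw [isAn_cls, ← cls_hypSum, ← cls_hypSum, ← cls_prod]
  intro hQ h
  have hd := congrArg icdim h
  rw [cls_prod, map_add, cls_hypSum, cls_hypSum, map_nsmul, map_nsmul, icdim_hc] at hd
  rw [cls_eq] at h
  obtain ⟨φ, hφ⟩ := h.symm
  let L : (Fin b → K) →ₗ[K] M × (Fin a → K × K) :=
    φ.toLinearMap ∘ₗ (LinearMap.pi fun i => (LinearMap.inl K K K) ∘ₗ LinearMap.proj i)
  let m : (Fin b → K) →ₗ[K] M := LinearMap.fst K _ _ ∘ₗ L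
  let X : (Fin b → K) →ₗ[K] (Fin a → K) :=
    LinearMap.pi fun i => LinearMap.fst K K K ∘ₗ LinearMap.proj i ∘ₗ LinearMap.snd K _ _ ∘ₗ L
  let Y : (Fin b → K) →ₗ[K] (Fin a → K) :=
    LinearMap.pi fun i => LinearMap.snd K K K ∘ₗ LinearMap.proj i ∘ₗ LinearMap.snd K _ _ ∘ₗ L
  have hL : Function.Injective L := by
    intro x y hxy
    have := φ.injective hxy
    funext i
    have := congrFun this i
    simpa using this
  have hform : ∀ x, Q (m x) + X x ⬝ᵥ Y x = 0 := by
    intro x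
    have := hφ (fun i => (x i, 0))
    simp [HypSum, hyp_apply] at this
    exact this
  have hm : ∀ k, Y k = 0 → m k = 0 := by
    intro k hk
    apply hQ
    simpa [hk] using hform k
  have horth : ∀ k, Y k = 0 → ∀ x, X k ⬝ᵥ Y x = 0 := by
    intro k hk x
    have h1 := hform (k + x)
    rw [m.map_add, X.map_add, Y.map_add, hm k hk, hk, zero_add, zero_add, add_dotProduct] at h1
    linear_combination h1 - hform x
  have hinj : ∀ k, Y k = 0 → X k = 0 → k = 0 := by
    intro k hk hk'
    apply hL
    rw [map_zero]
    refine Prod.ext (hm k hk) (funext fun i => Prod.ext ?_ ?_)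
    · exact congrFun hk' i
    · exact congrFun hk i
  let T : LinearMap.ker Y →ₗ[K] (LinearMap.range Y).dualAnnihilator :=
    LinearMap.codRestrict _ ((dotProductEquiv K (Fin a)).toLinearMap ∘ₗ X ∘ₗ
      (LinearMap.ker Y).subtype) (by
      rintro ⟨k, hk⟩
      rw [Submodule.mem_dualAnnihilator]
      rintro _ ⟨x, rfl⟩
      exact horth k hk x)
  have hT : Function.Injective T := by
    refine (injective_iff_map_eq_zero T).mpr ?_
    rintro ⟨k, hk⟩ h0
    have h1 := congrArg Subtype.val h0
    have h2 : dotProductEquiv K (Fin a) (X k) = 0 := h1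
    rw [map_eq_zero_iff _ (LinearEquiv.injective _)] at h2
    exact Subtype.ext (hinj k hk h2)
  have h3 := LinearMap.finrank_le_finrank_of_injective hT
  have h4 := Subspace.finrank_add_finrank_dualAnnihilator_eq (LinearMap.range Y)
  have h5 := LinearMap.finrank_range_add_finrank_ker Y
  simp only [Module.finrank_fin_fun] at h4 h5
  simp only [smul_eq_mul] at hd
  omega
end classes

/-- the set of Witt classes realised in dimension `j` -/
def CC {W : Type} [Fintype W] (d : W → ℕ) (j : ℕ) : Finset W :=
  Finset.univ.filter (fun v => d v ≤ j ∧ d v % 2 = j % 2)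

/-- Finite combinatorial facts about the Witt group. -/
structure CountFacts (W : Type) [AddCommGroup W] [Fintype W] [DecidableEq W] (d : W → ℕ) :
    Prop where
  par : ∀ v w, d (v + w) % 2 = (d v + d w) % 2
  le4 : ∀ w, d w ≤ 4
  d0 : ∀ w, d w = 0 ↔ w = 0
  card1 : (CC d 1).card = 4
  card2 : (CC d 2).card = 7
  card3 : (CC d 3).card = 8
  card4 : (CC d 4).card = 8
  A1 : ∀ w, ∑ v ∈ CC d 1, (2 - (d (w - v) : ℤ)) = 2 * (2 - (d w : ℤ))
  A2 : ∀ w, ∑ v ∈ CC d 2, (2 - (d (w - v) : ℤ)) = 2 - (d w : ℤ)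
  A3 : ∀ w, ∑ v ∈ CC d 3, (2 - (d (w - v) : ℤ)) = 0
  A4 : ∀ w, ∑ v ∈ CC d 4, (2 - (d (w - v) : ℤ)) = 0
  B1 : ∀ w, d w % 2 = 1 → ∑ v ∈ CC d 1, (8 * (if d (w - v) = 0 then 1 else 0) - 1 : ℤ) =
    4 * (2 - (d w : ℤ))
  B2 : ∀ w, d w % 2 = 0 → ∑ v ∈ CC d 2, (8 * (if d (w - v) = 0 then 1 else 0) - 1 : ℤ) =
    1 - 8 * (if d w = 4 then 1 else 0)
  B3 : ∀ w, d w % 2 = 1 → ∑ v ∈ CC d 3, (8 * (if d (w - v) = 0 then 1 else 0) - 1 : ℤ) = 0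
  B4 : ∀ w, d w % 2 = 0 → ∑ v ∈ CC d 4, (8 * (if d (w - v) = 0 then 1 else 0) - 1 : ℤ) = 0
  D1 : ∀ w, d w % 2 = 1 → ∑ v ∈ CC d 1, (8 * (if d (w - v) = 4 then 1 else 0) - 1 : ℤ) =
    - (4 * (2 - (d w : ℤ)))
  D2 : ∀ w, d w % 2 = 0 → ∑ v ∈ CC d 2, (8 * (if d (w - v) = 4 then 1 else 0) - 1 : ℤ) =
    1 - 8 * (if d w = 0 then 1 else 0)
  D3 : ∀ w, d w % 2 = 1 → ∑ v ∈ CC d 3, (8 * (if d (w - v) = 4 then 1 else 0) - 1 : ℤ) = 0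
  D4 : ∀ w, d w % 2 = 0 → ∑ v ∈ CC d 4, (8 * (if d (w - v) = 4 then 1 else 0) - 1 : ℤ) = 0

/-- dimension on the half group, first case -/
def dI (α : ZMod 2 × ZMod 2) : ℕ := α.1.val + α.2.val

/-- dimension on the half group, second case -/
def dII (α : ZMod 4) : ℕ := if α = 0 then 0 else if α = 2 then 2 else 1

/-- dimension on the product -/
def dW {A : Type} (d : A → ℕ) (w : A × A) : ℕ := d w.1 + d w.2

theorem countI : CountFacts ((ZMod 2 × ZMod 2) × (ZMod 2 × ZMod 2)) (dW dI) := by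
  constructor <;> decide +kernel

theorem countII : CountFacts (ZMod 4 × ZMod 4) (dW dII) := by
  constructor <;> decide +kernel

/-- A model of half the Witt group. -/
structure HalfModel {K : Type} [Field K] (A : Type) [AddCommGroup A] (d : A → ℕ) (r : A → IC K)
    (x : IC K) : Prop where
  zero : r 0 = 0
  add : ∀ α β, ∃ j : ℕ, r α + r β = r (α + β) + j • hc K
  compl : ∀ α, ∃ z, r α + z = x
  dim : ∀ α, icdim (r α) = d α

/-- A model of the Witt group. -/
structure WModel {K : Type} [Field K] (W : Type) [AddCommGroup W] (d : W → ℕ) (R : W → IC K) :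
    Prop where
  zero : R 0 = 0
  add : ∀ α β, ∃ j : ℕ, R α + R β = R (α + β) + j • hc K
  an : ∀ α, IsAn (R α)
  dim : ∀ α, icdim (R α) = d α
  qc : ∀ a : K, a ≠ 0 → ∃ w, qc a = R w

theorem HalfModel.prod {K : Type} [Field K] {A : Type} [AddCommGroup A] {d : A → ℕ}
    {r r' : A → IC K} {x x' : IC K} (h : HalfModel A d r x) (h' : HalfModel A d r' x')
    (han : IsAn (x + x')) (hq : ∀ a : K, a ≠ 0 → ∃ α, qc a = r α ∨ qc a = r' α) :
    WModel (A × A) (dW d) (fun w => r w.1 + r' w.2) where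
  zero := by simp [h.zero, h'.zero]
  add := by
    rintro ⟨α, α'⟩ ⟨β, β'⟩
    obtain ⟨j, hj⟩ := h.add α β
    obtain ⟨j', hj'⟩ := h'.add α' β'
    refine ⟨j + j', ?_⟩
    simp only [Prod.mk_add_mk]
    rw [add_add_add_comm, hj, hj', add_nsmul]
    abel
  an := by
    rintro ⟨α, α'⟩
    obtain ⟨z, hz⟩ := h.compl α
    obtain ⟨z', hz'⟩ := h'.compl α'
    apply IsAn.left (y := z + z')
    rw [add_add_add_comm, hz, hz']
    exact han
  dim := by
    rintro ⟨α, α'⟩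
    simp [h.dim, h'.dim, dW]
  qc := by
    intro a ha
    obtain ⟨α, h1 | h1⟩ := hq a ha
    · exact ⟨(α, 0), by simp [h1, h'.zero]⟩
    · exact ⟨(0, α), by simp [h1, h.zero]⟩

/-- first case -/
noncomputable def rI {K : Type} [Field K] (c u : K) (α : ZMod 2 × ZMod 2) : IC K :=
  α.1.val • qc c + α.2.val • qc (c * u)

theorem zmod2_add {M : Type*} [AddCommMonoid M] (x h : M) (hx : x + x = h) (a b : ZMod 2) :
    ∃ j : ℕ, a.val • x + b.val • x = (a + b).val • x + j • h := by
  have h2 : ∀ a : ZMod 2, a = 0 ∨ a = 1 := by decide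
  rcases h2 a with rfl | rfl <;> rcases h2 b with rfl | rfl
  · exact ⟨0, by simp⟩
  · exact ⟨0, by simp⟩
  · exact ⟨0, by simp⟩
  · refine ⟨1, ?_⟩
    have : (1 + 1 : ZMod 2) = 0 := by decide
    rw [this, ZMod.val_zero, ZMod.val_one]
    simp [hx]

theorem zmod2_compl {M : Type*} [AddCommMonoid M] (x : M) (a : ZMod 2) :
    ∃ z, a.val • x + z = x := by
  have h2 : ∀ a : ZMod 2, a = 0 ∨ a = 1 := by decide
  rcases h2 a with rfl | rfl
  · exact ⟨x, by simp⟩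
  · exact ⟨0, by rw [ZMod.val_one]; simp⟩

theorem halfI {K : Type} [Field K] (c u : K) (h1 : qc c + qc c = hc K)
    (h2 : qc (c * u) + qc (c * u) = hc K) :
    HalfModel (ZMod 2 × ZMod 2) dI (rI c u) (qc c + qc (c * u)) where
  zero := by simp [rI]
  add := by
    rintro ⟨α, α'⟩ ⟨β, β'⟩
    obtain ⟨j, hj⟩ := zmod2_add _ _ h1 α β
    obtain ⟨j', hj'⟩ := zmod2_add _ _ h2 α' β'
    refine ⟨j + j', ?_⟩
    simp only [rI, Prod.mk_add_mk]
    rw [add_add_add_comm, hj, hj', add_nsmul]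
    abel
  compl := by
    rintro ⟨α, α'⟩
    obtain ⟨z, hz⟩ := zmod2_compl (qc c) α
    obtain ⟨z', hz'⟩ := zmod2_compl (qc (c * u)) α'
    refine ⟨z + z', ?_⟩
    simp only [rI]
    rw [add_add_add_comm, hz, hz']
  dim := by
    rintro ⟨α, α'⟩
    simp [rI, dI, icdim_qc]

/-- second case -/
noncomputable def rII {K : Type} [Field K] (c : K) (α : ZMod 4) : IC K :=
  if α = 0 then 0 else if α = 1 then qc c else if α = 2 then qc c + qc c else qc (-c)

theorem halfII {K : Type} [Field K] (c : K) (h1 : qc c + qc (-c) = hc K)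
    (h2 : qc c + qc c = qc (-c) + qc (-c)) :
    HalfModel (ZMod 4) dII (rII c) (qc c + qc c) := by
  have hz : ∀ a : ZMod 4, a = 0 ∨ a = 1 ∨ a = 2 ∨ a = 3 := by decide
  have e0 : rII c 0 = 0 := by simp [rII]
  have e1 : rII c 1 = qc c := by
    simp [rII, show (1 : ZMod 4) ≠ 0 by decide]
  have e2 : rII c 2 = qc c + qc c := by
    simp [rII, show (2 : ZMod 4) ≠ 0 by decide, show (2 : ZMod 4) ≠ 1 by decide]
  have e3 : rII c 3 = qc (-c) := by
    simp [rII, show (3 : ZMod 4) ≠ 0 by decide, show (3 : ZMod 4) ≠ 1 by decide,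
      show (3 : ZMod 4) ≠ 2 by decide]
  refine ⟨e0, ?_, ?_, ?_⟩
  · have key : ∀ α β γ : ZMod 4, α + β = γ → (∃ j : ℕ, rII c α + rII c β = rII c γ + j • hc K) →
        ∃ j : ℕ, rII c α + rII c β = rII c (α + β) + j • hc K := by
      rintro α β γ rfl h; exact h
    have comm : ∀ α β : ZMod 4, (∃ j : ℕ, rII c α + rII c β = rII c (α + β) + j • hc K) →
        ∃ j : ℕ, rII c β + rII c α = rII c (β + α) + j • hc K := by
      rintro α β h; rwa [add_comm β α, add_comm (rII c β)]
    have z : ∀ β : ZMod 4, ∃ j : ℕ, rII c 0 + rII c β = rII c (0 + β) + j • hc K :=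
      fun β => ⟨0, by simp [e0]⟩
    have k11 := key 1 1 2 (by decide) ⟨0, by simp [e1, e2]⟩
    have k12 := key 1 2 3 (by decide) ⟨1, by
      rw [e1, e2, e3, h2, one_nsmul, ← h1]; abel⟩
    have k13 := key 1 3 0 (by decide) ⟨1, by rw [e1, e3, e0, h1]; simp⟩
    have k22 := key 2 2 0 (by decide) ⟨2, by
      rw [e2, e0]; nth_rewrite 2 [h2]; rw [← h1]; abel⟩
    have k23 := key 2 3 1 (by decide) ⟨1, by rw [e1, e3, e2, ← h1]; abel⟩
    have k33 := key 3 3 2 (by decide) ⟨0, by rw [e3, e2, h2]; simp⟩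
    intro α β
    rcases hz α with rfl | rfl | rfl | rfl <;> rcases hz β with rfl | rfl | rfl | rfl
    all_goals first
      | exact z _
      | exact comm _ _ (z _)
      | assumption
      | (apply comm; assumption)
  · intro α
    rcases hz α with rfl | rfl | rfl | rfl
    · exact ⟨qc c + qc c, by simp [e0]⟩
    · exact ⟨qc c, by simp [e1]⟩
    · exact ⟨0, by simp [e2]⟩
    · exact ⟨qc (-c), by rw [e3, h2]⟩
  · intro α
    rcases hz α with rfl | rfl | rfl | rfl
    · rw [e0]; simp [dII]
    · rw [e1, icdim_qc]; decide
    · rw [e2, map_add, icdim_qc]; decide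
    · rw [e3, icdim_qc]; decide

theorem exists_model {K : Type} [Field K] (h2 : (2 : K) ≠ 0) (u t : K)
    (han : ∀ x y z w : K, x ^ 2 + u * y ^ 2 + t * (z ^ 2 + u * w ^ 2) = 0 →
      x = 0 ∧ y = 0 ∧ z = 0 ∧ w = 0)
    (hsq : ∀ x : K, x ≠ 0 → ∃ y, y ≠ 0 ∧ (x = y ^ 2 ∨ x = -u * y ^ 2 ∨ x = t * y ^ 2 ∨
      x = t * -u * y ^ 2))
    (hi : (∃ i : K, i ^ 2 = -1) ∨ (u = 1 ∧ ∃ a b : K, a ^ 2 + b ^ 2 = -1)) :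
    ∃ (W : Type) (_ : AddCommGroup W) (_ : Fintype W) (_ : DecidableEq W) (d : W → ℕ)
      (R : W → IC K), CountFacts W d ∧ WModel W d R := by
  have hfull := full_an u t han
  have hu : u ≠ 0 := by
    rintro rfl
    have := han 0 1 0 0 (by ring)
    simp at this
  have ht : t ≠ 0 := by
    rintro rfl
    have := han 0 0 1 0 (by ring)
    simp at this
  rcases hi with ⟨i, hi⟩ | ⟨rfl, a, b, hab⟩
  · have hi0 : i ≠ 0 := by rintro rfl; simp at hi
    have hneg : ∀ c : K, qc (-c) = qc c := by
      intro c
      rw [← qc_mul_sq c i hi0, hi, mul_neg, mul_one]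
    have hdd : ∀ c : K, c ≠ 0 → qc c + qc c = hc K := by
      intro c hc0
      rw [← qc_add_neg h2 c hc0, hneg]
    have H1 := halfI (1 : K) u (hdd 1 one_ne_zero) (hdd _ (by simpa using hu))
    have H2 := halfI t u (hdd t ht) (hdd _ (mul_ne_zero ht hu))
    refine ⟨_, inferInstance, inferInstance, inferInstance, _, _, countI, H1.prod H2 ?_ ?_⟩
    · rw [one_mul]; exact hfull
    · intro x hx
      have v1 : (1 : ZMod 2).val = 1 := by decide
      obtain ⟨y, hy, h | h | h | h⟩ := hsq x hx
      · refine ⟨(1, 0), Or.inl ?_⟩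
        rw [h, ← one_mul (y ^ 2), qc_mul_sq _ _ hy]
        simp [rI, v1]
      · refine ⟨(0, 1), Or.inl ?_⟩
        rw [h, qc_mul_sq _ _ hy, hneg]
        simp [rI, v1]
      · refine ⟨(1, 0), Or.inr ?_⟩
        rw [h, qc_mul_sq _ _ hy]
        simp [rI, v1]
      · refine ⟨(0, 1), Or.inr ?_⟩
        rw [h, qc_mul_sq _ _ hy, mul_neg, hneg]
        simp [rI, v1]
  · have H1 := halfII (1 : K) (qc_add_neg h2 1 one_ne_zero) (qc_two a b 1 hab)
    have H2 := halfII t (qc_add_neg h2 t ht) (qc_two a b t hab)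
    refine ⟨_, inferInstance, inferInstance, inferInstance, _, _, countII, H1.prod H2 ?_ ?_⟩
    · rw [mul_one] at hfull; exact hfull
    · have e1 : ∀ c : K, rII c 1 = qc c := by
        intro c
        simp [rII, show (1 : ZMod 4) ≠ 0 by decide]
      have e3 : ∀ c : K, rII c 3 = qc (-c) := by
        intro c
        simp [rII, show (3 : ZMod 4) ≠ 0 by decide, show (3 : ZMod 4) ≠ 1 by decide,
          show (3 : ZMod 4) ≠ 2 by decide]
      intro x hx
      obtain ⟨y, hy, h | h | h | h⟩ := hsq x hx
      · refine ⟨1, Or.inl ?_⟩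
        rw [h, ← one_mul (y ^ 2), qc_mul_sq _ _ hy, e1]
      · refine ⟨3, Or.inl ?_⟩
        rw [h, qc_mul_sq _ _ hy, e3]
      · refine ⟨1, Or.inr ?_⟩
        rw [h, qc_mul_sq _ _ hy, e1]
      · refine ⟨3, Or.inr ?_⟩
        rw [h, qc_mul_sq _ _ hy, e3, mul_neg, mul_one]

section model
variable {K : Type} [Field K] {W : Type} [AddCommGroup W] {d : W → ℕ} {R : W → IC K}

/-- `x` has Witt class `w` -/
def HasW (R : W → IC K) (x : IC K) (w : W) : Prop := ∃ k : ℕ, x = R w + k • hc K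

theorem HasW.add (hM : WModel W d R) {x y : IC K} {v w : W} (hx : HasW R x v) (hy : HasW R y w) :
    HasW R (x + y) (v + w) := by
  obtain ⟨k, rfl⟩ := hx
  obtain ⟨l, rfl⟩ := hy
  obtain ⟨j, hj⟩ := hM.add v w
  refine ⟨j + (k + l), ?_⟩
  rw [add_add_add_comm, hj, add_nsmul, add_nsmul]
  abel

theorem HasW.zero (hM : WModel W d R) : HasW R (0 : IC K) 0 := ⟨0, by simp [hM.zero]⟩

theorem HasW.sum (hM : WModel W d R) {ι : Type} (s : Finset ι) {x : ι → IC K} {f : ι → W}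
    (h : ∀ i ∈ s, HasW R (x i) (f i)) : HasW R (∑ i ∈ s, x i) (∑ i ∈ s, f i) := by
  classical
  induction s using Finset.induction_on with
  | empty => simpa using HasW.zero hM
  | insert a s ha ih =>
    rw [Finset.sum_insert ha, Finset.sum_insert ha]
    exact (h a (by simp)).add hM (ih fun i hi => h i (by simp [hi]))

theorem HasW.unique (hM : WModel W d R) (h0 : ∀ w, d w = 0 → w = 0) {x : IC K}
    {v w : W} (hx : HasW R x v) (hy : HasW R x w) (h2 : (2 : K) ≠ 0) : v = w := by
  have hw : HasW R (R (-w)) (-w) := ⟨0, by simp⟩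
  obtain ⟨k, hk⟩ := hx.add hM hw
  obtain ⟨l, hl⟩ := hy.add hM hw
  rw [add_neg_cancel, hM.zero, zero_add] at hl
  have h := hyp_iso h2 (hM.an _) (hk.symm.trans hl)
  rw [hM.dim] at h
  have := h0 _ h
  rwa [← sub_eq_add_neg, sub_eq_zero] at this

theorem HasW.exists (hM : WModel W d R) (h2 : (2 : K) ≠ 0) {x : IC K} (hx : IsND x) :
    ∃ w, HasW R x w := by
  obtain ⟨m, a, rfl⟩ := hx.exists_sum h2
  have : ∀ i, ∃ w, HasW R (qc (a i : K)) w := by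
    intro i
    obtain ⟨w, hw⟩ := hM.qc (a i) (a i).ne_zero
    exact ⟨w, 0, by simp [hw]⟩
  choose f hf using this
  exact ⟨_, HasW.sum hM _ (fun i _ => hf i)⟩

theorem HasW.hyp (hM : WModel W d R) (k : ℕ) : HasW R (k • hc K) 0 := ⟨k, by simp [hM.zero]⟩

theorem HasW.dim (hM : WModel W d R) {x : IC K} {w : W} (h : HasW R x w) :
    d w ≤ icdim x ∧ d w % 2 = icdim x % 2 := by
  obtain ⟨k, rfl⟩ := h
  rw [map_add, map_nsmul, icdim_hc, hM.dim, smul_eq_mul]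
  omega

theorem HasW.eq (hM : WModel W d R) {x y : IC K} {w : W} (h : HasW R x w) (h' : HasW R y w)
    (hd : icdim x = icdim y) : x = y := by
  obtain ⟨k, rfl⟩ := h
  obtain ⟨l, rfl⟩ := h'
  rw [map_add, map_add, map_nsmul, map_nsmul, icdim_hc, smul_eq_mul, smul_eq_mul] at hd
  have : k = l := by omega
  rw [this]

theorem HasW.an_dim (hM : WModel W d R) {x : IC K} {w : W} (h : HasW R x w) (hx : IsAn x) :
    d w = icdim x := by
  obtain ⟨k, rfl⟩ := h
  cases k with
  | zero => simp [hM.dim]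
  | succ k =>
    rw [succ_nsmul, ← add_assoc] at hx
    exact absurd hx (not_isAn_hc _)

theorem exists_form (hM : WModel W d R) (h2 : (2 : K) ≠ 0) (m : ℕ) (w : W) (h1 : d w ≤ m)
    (hp : d w % 2 = m % 2) : ∃ Q : QF K m, QNondeg Q ∧ HasW R (cls Q) w := by
  obtain ⟨Q, hQ⟩ := exists_rep (R w + ((m - d w) / 2) • hc K) m (by
    rw [map_add, map_nsmul, icdim_hc, hM.dim, smul_eq_mul]
    omega)
  refine ⟨Q, ?_, _, hQ⟩
  rw [← isND_cls, hQ]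
  exact (IsAn.nd h2 (hM.an w)).add (isND_nsmul_hc _)

theorem icdim_qf {m : ℕ} (Q : QF K m) : icdim (cls Q) = m := by
  rw [icdim_cls]; simp

/-- The number of tuples as a count in the Witt group. -/
theorem card_quot [Fintype W] [DecidableEq W] (hM : WModel W d R) (h0 : ∀ w, d w = 0 → w = 0)
    (h2 : (2 : K) ≠ 0) {s : ℕ} (e : Fin s → ℕ) {D : ℕ} (Q₀ : QF K D)
    (hQ₀ : QuadraticMap.Anisotropic Q₀) :
    ∃ w₀ : W, d w₀ = D ∧ Nat.card (Quot (fun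
      (Qt Qt' : {Qt : ∀ i : Fin s, QF K (e i) //
        (∀ i, QNondeg (Qt i)) ∧ WittEquiv (QuadraticMap.pi (fun i => Qt i)) Q₀}) =>
      ∀ i, QIsom (Qt.1 i) (Qt'.1 i))) =
      Nat.card {f : Fin s → W // (∀ i, f i ∈ CC d (e i)) ∧ ∑ i, f i = w₀} := by
  have hA : IsAn (cls Q₀) := (isAn_cls Q₀).mpr hQ₀
  obtain ⟨w₀, hw₀⟩ := HasW.exists hM h2 (IsAn.nd h2 hA)
  refine ⟨w₀, by rw [hw₀.an_dim hM hA, icdim_qf], ?_⟩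
  have hex : ∀ Qt : {Qt : ∀ i : Fin s, QF K (e i) //
        (∀ i, QNondeg (Qt i)) ∧ WittEquiv (QuadraticMap.pi (fun i => Qt i)) Q₀},
      ∃ f : Fin s → W, ∀ i, HasW R (cls (Qt.1 i)) (f i) := by
    intro Qt
    have : ∀ i, ∃ w, HasW R (cls (Qt.1 i)) w := fun i =>
      HasW.exists hM h2 ((isND_cls _).mpr (Qt.2.1 i))
    choose f hf using this
    exact ⟨f, hf⟩
  choose F hF using hex
  have hFmem : ∀ Qt, (∀ i, F Qt i ∈ CC d (e i)) ∧ ∑ i, F Qt i = w₀ := by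
    intro Qt
    constructor
    · intro i
      have := (hF Qt i).dim hM
      rw [icdim_qf] at this
      simpa [CC] using this
    · obtain ⟨a, b, hab⟩ := (witt_iff _ _).mp Qt.2.2
      have k1 : HasW R (cls (QuadraticMap.pi (fun i => Qt.1 i))) (∑ i, F Qt i) := by
        rw [cls_pi]
        exact HasW.sum hM _ (fun i _ => hF Qt i)
      have k2 := k1.add hM (HasW.hyp hM a)
      have k3 := hw₀.add hM (HasW.hyp hM b)
      rw [hab] at k2
      simpa using HasW.unique hM h0 k2 k3 h2
  refine Nat.card_eq_of_bijective (Quot.lift (fun Qt => ⟨F Qt, hFmem Qt⟩) ?_) ⟨?_, ?_⟩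
  · intro Qt Qt' h
    apply Subtype.ext
    funext i
    have k := hF Qt' i
    rw [← cls_eq.mpr (h i)] at k
    exact HasW.unique hM h0 (hF Qt i) k h2
  · rintro ⟨Qt⟩ ⟨Qt'⟩ h
    apply Quot.sound
    intro i
    have h' : F Qt = F Qt' := congrArg Subtype.val h
    rw [← cls_eq]
    refine HasW.eq hM (hF Qt i) ?_ (by rw [icdim_qf, icdim_qf])
    rw [h']
    exact hF Qt' i
  · rintro ⟨f, hf, hs⟩
    have : ∀ i, ∃ Q : QF K (e i), QNondeg Q ∧ HasW R (cls Q) (f i) := by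
      intro i
      have := hf i
      simp [CC] at this
      exact exists_form hM h2 _ _ this.1 this.2
    choose Qs hn hw using this
    have hsum : HasW R (cls (QuadraticMap.pi (fun i => Qs i))) w₀ := by
      rw [cls_pi, ← hs]
      exact HasW.sum hM _ (fun i _ => hw i)
    refine ⟨Quot.mk _ ⟨Qs, hn, ?_⟩, ?_⟩
    · rw [witt_iff]
      obtain ⟨k, hk⟩ := hsum
      obtain ⟨l, hl⟩ := hw₀
      refine ⟨l, k, ?_⟩
      rw [hk, hl, add_right_comm]
    · apply Subtype.ext
      funext i
      exact HasW.unique hM h0 (hF _ i) (hw i) h2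
end model

section counting
variable {W : Type} [AddCommGroup W] [Fintype W] [DecidableEq W] {d : W → ℕ}

/-- the closed formula for eight times the count -/
def GG (a b c n D : ℕ) : ℤ :=
  if D % 2 = n % 2 then 4 ^ a * 7 ^ b * 8 ^ c + (if 0 < c then 0 else if 0 < a then
    (2 - (D : ℤ)) * 2 ^ (a + 1) else (-1) ^ b * (8 * (if D = 4 * (b % 2) then 1 else 0) - 1))
  else 0

/-- the count -/
def NN (d : W → ℕ) {s : ℕ} (e : Fin s → ℕ) (w : W) : ℤ :=
  ∑ f : Fin s → W, if (∀ i, f i ∈ CC d (e i)) ∧ ∑ i, f i = w then 1 else 0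

theorem NN_eq {s : ℕ} (e : Fin s → ℕ) (w : W) :
    (Nat.card {f : Fin s → W // (∀ i, f i ∈ CC d (e i)) ∧ ∑ i, f i = w} : ℤ) = NN d e w := by
  rw [Nat.card_eq_fintype_card, Fintype.card_subtype, NN, Finset.card_filter]
  push_cast
  rfl

theorem NN_succ {s : ℕ} (e : Fin (s + 1) → ℕ) (w : W) :
    NN d e w = ∑ v ∈ CC d (e 0), NN d (fun i => e i.succ) (w - v) := by
  unfold NN
  rw [← Equiv.sum_comp (Fin.consEquiv (fun _ : Fin (s + 1) => W)), Fintype.sum_prod_type,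
    ← Finset.sum_filter_add_sum_filter_not Finset.univ (fun v => v ∈ CC d (e 0))]
  rw [Finset.sum_eq_zero (s := Finset.univ.filter (fun v => ¬ v ∈ CC d (e 0))), add_zero]
  · have : Finset.univ.filter (fun v => v ∈ CC d (e 0)) = CC d (e 0) := by ext; simp
    rw [this]
    refine Finset.sum_congr rfl fun v hv => Finset.sum_congr rfl fun f _ => ?_
    congr 1
    simp [Fin.forall_fin_succ, Fin.sum_univ_succ, hv, eq_sub_iff_add_eq']
  · intro v hv
    refine Finset.sum_eq_zero fun f _ => ?_
    simp at hv
    simp [Fin.forall_fin_succ, hv]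

theorem GG_sum_off (h : CountFacts W d) (a b c n m a' b' c' : ℕ) (w : W)
    (hw : d w % 2 ≠ (m + n) % 2) :
    ∑ v ∈ CC d m, GG a b c n (d (w - v)) = GG a' b' c' (m + n) (d w) := by
  unfold GG
  rw [if_neg hw]
  refine Finset.sum_eq_zero fun v hv => if_neg ?_
  have h1 := h.par (w - v) v
  rw [sub_add_cancel] at h1
  simp [CC] at hv
  omega

theorem GG_sum_on (h : CountFacts W d) (a b c n m : ℕ) (w : W)
    (hw : d w % 2 = (m + n) % 2) :
    ∑ v ∈ CC d m, GG a b c n (d (w - v)) = (CC d m).card * (4 ^ a * 7 ^ b * 8 ^ c) +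
      (if 0 < c then 0 else if 0 < a then
      (∑ v ∈ CC d m, (2 - (d (w - v) : ℤ))) * 2 ^ (a + 1) else
      (-1) ^ b * ∑ v ∈ CC d m, (8 * (if d (w - v) = 4 * (b % 2) then 1 else 0) - 1)) := by
  have : ∀ v ∈ CC d m, GG a b c n (d (w - v)) = 4 ^ a * 7 ^ b * 8 ^ c + (if 0 < c then 0 else if 0 < a then
    (2 - (d (w - v) : ℤ)) * 2 ^ (a + 1) else (-1) ^ b * (8 * (if d (w - v) = 4 * (b % 2) then 1 else 0) - 1)) := by
    intro v hv
    unfold GG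
    apply if_pos
    have h1 := h.par (w - v) v
    rw [sub_add_cancel] at h1
    simp [CC] at hv
    omega
  rw [Finset.sum_congr rfl this, Finset.sum_add_distrib, Finset.sum_const, nsmul_eq_mul]
  congr 1
  split_ifs
  · simp
  · rw [Finset.sum_mul]
  · rw [Finset.mul_sum]

theorem CC_ge (h : CountFacts W d) (m : ℕ) (hm : 3 ≤ m) : CC d m = CC d 3 ∨ CC d m = CC d 4 := by
  rcases Nat.mod_two_eq_zero_or_one m with h0 | h0
  · right
    ext v
    have := h.le4 v
    simp [CC]
    omega
  · left
    ext v
    have := h.le4 v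
    simp [CC]
    omega

theorem GG_step1 (h : CountFacts W d) (a b c n : ℕ) (hn : a = 0 → c = 0 → n % 2 = 0) (w : W) :
    ∑ v ∈ CC d 1, GG a b c n (d (w - v)) = GG (a + 1) b c (1 + n) (d w) := by
  by_cases hw : d w % 2 = (1 + n) % 2
  swap
  · exact GG_sum_off h _ _ _ _ _ _ _ _ _ hw
  rw [GG_sum_on h _ _ _ _ _ _ hw, h.card1, h.A1]
  unfold GG
  rw [if_pos hw]
  by_cases hc : 0 < c
  · simp [hc]; ring
  by_cases ha : 0 < a
  · simp [hc, ha]; ring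
  obtain rfl : a = 0 := by omega
  obtain rfl : c = 0 := by omega
  have := hn rfl rfl
  simp only [lt_irrefl, if_false, Nat.zero_lt_succ, if_true]
  rcases Nat.mod_two_eq_zero_or_one b with h0 | h0
  · rw [h0, mul_zero, h.B1 w (by omega), (Nat.even_iff.mpr h0).neg_one_pow]
    push_cast; ring
  · rw [h0, mul_one, h.D1 w (by omega), (Nat.odd_iff.mpr h0).neg_one_pow]
    push_cast; ring

theorem GG_step2 (h : CountFacts W d) (a b c n : ℕ) (hn : a = 0 → c = 0 → n % 2 = 0) (w : W) :
    ∑ v ∈ CC d 2, GG a b c n (d (w - v)) = GG a (b + 1) c (2 + n) (d w) := by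
  by_cases hw : d w % 2 = (2 + n) % 2
  swap
  · exact GG_sum_off h _ _ _ _ _ _ _ _ _ hw
  rw [GG_sum_on h _ _ _ _ _ _ hw, h.card2, h.A2]
  unfold GG
  rw [if_pos hw]
  by_cases hc : 0 < c
  · simp [hc]; ring
  by_cases ha : 0 < a
  · simp [hc, ha]; ring
  obtain rfl : a = 0 := by omega
  obtain rfl : c = 0 := by omega
  have := hn rfl rfl
  simp only [lt_irrefl, if_false]
  rcases Nat.mod_two_eq_zero_or_one b with h0 | h0
  · rw [h0, mul_zero, h.B2 w (by omega), (Nat.even_iff.mpr h0).neg_one_pow,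
      show (b + 1) % 2 = 1 by omega, (Nat.odd_iff.mpr (show (b + 1) % 2 = 1 by omega)).neg_one_pow]
    push_cast; ring
  · rw [h0, mul_one, h.D2 w (by omega), (Nat.odd_iff.mpr h0).neg_one_pow,
      show (b + 1) % 2 = 0 by omega, (Nat.even_iff.mpr (show (b + 1) % 2 = 0 by omega)).neg_one_pow]
    push_cast; ring

theorem GG_step3 (h : CountFacts W d) (a b c n m : ℕ) (hm : 3 ≤ m)
    (hn : a = 0 → c = 0 → n % 2 = 0) (w : W) :
    ∑ v ∈ CC d m, GG a b c n (d (w - v)) = GG a b (c + 1) (m + n) (d w) := by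
  by_cases hw : d w % 2 = (m + n) % 2
  swap
  · exact GG_sum_off h _ _ _ _ _ _ _ _ _ hw
  rw [GG_sum_on h _ _ _ _ _ _ hw]
  have hcard : (CC d m).card = 8 := by
    rcases CC_ge h m hm with e | e <;> rw [e]
    · exact h.card3
    · exact h.card4
  have hA : ∑ v ∈ CC d m, (2 - (d (w - v) : ℤ)) = 0 := by
    rcases CC_ge h m hm with e | e <;> rw [e]
    · exact h.A3 w
    · exact h.A4 w
  have hB : ¬ 0 < c → ¬ 0 < a →
      ∑ v ∈ CC d m, (8 * (if d (w - v) = 4 * (b % 2) then 1 else 0) - 1 : ℤ) = 0 := by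
    intro hc ha
    have := hn (by omega) (by omega)
    have e3 : d w % 2 = 1 → CC d m = CC d 3 := by
      intro hp
      ext v
      have := h.le4 v
      simp [CC]
      omega
    have e4 : d w % 2 = 0 → CC d m = CC d 4 := by
      intro hp
      ext v
      have := h.le4 v
      simp [CC]
      omega
    rcases Nat.mod_two_eq_zero_or_one b with h0 | h0 <;>
      rcases Nat.mod_two_eq_zero_or_one (d w) with h1 | h1
    · rw [h0, e4 h1]; exact h.B4 w h1
    · rw [h0, e3 h1]; exact h.B3 w h1
    · rw [h0, e4 h1]; exact h.D4 w h1
    · rw [h0, e3 h1]; exact h.D3 w h1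
  rw [hcard, hA]
  unfold GG
  rw [if_pos hw, if_pos (Nat.succ_pos c)]
  by_cases hc : 0 < c
  · simp [hc]; ring
  by_cases ha : 0 < a
  · simp [hc, ha]; ring
  rw [hB hc ha]
  simp [hc, ha]; ring

theorem NN_formula (h : CountFacts W d) {s : ℕ} (e : Fin s → ℕ) (he : ∀ i, 1 ≤ e i) (w : W) :
    8 * NN d e w = GG (∑ i, if e i = 1 then 1 else 0) (∑ i, if e i = 2 then 1 else 0)
      (∑ i, if 3 ≤ e i then 1 else 0) (∑ i, e i) (d w) := by
  induction s generalizing w with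
  | zero =>
    simp only [NN, GG, Finset.univ_eq_empty, Finset.sum_empty]
    have := h.d0 w
    by_cases hw : w = 0
    · subst hw
      simp [this.mpr rfl]
    · have h1 : d w ≠ 0 := fun h => hw (this.mp h)
      simp [h1, Ne.symm hw]
  | succ s ih =>
    rw [NN_succ, Finset.mul_sum]
    rw [Finset.sum_congr rfl (fun v _ => ih (fun i => e i.succ) (fun i => he _) (w - v))]
    simp only [Fin.sum_univ_succ (n := s)]
    have hn : (∑ i : Fin s, if e i.succ = 1 then 1 else 0) = 0 →
        (∑ i : Fin s, if 3 ≤ e i.succ then 1 else 0) = 0 → (∑ i : Fin s, e i.succ) % 2 = 0 := by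
      intro h1 h3
      rw [Finset.sum_eq_zero_iff] at h1 h3
      rw [← Nat.dvd_iff_mod_eq_zero]
      refine Finset.dvd_sum fun i hi => ?_
      have k1 := h1 i hi
      have k3 := h3 i hi
      have := he i.succ
      simp at k1 k3
      have : e i.succ = 2 := by omega
      rw [this]
    have h0 := he 0
    obtain h1 | h1 | h1 : e 0 = 1 ∨ e 0 = 2 ∨ 3 ≤ e 0 := by omega
    · rw [h1, GG_step1 h _ _ _ _ hn]
      norm_num [add_comm]
    · rw [h1, GG_step2 h _ _ _ _ hn]
      norm_num [add_comm]
    · rw [GG_step3 h _ _ _ _ _ h1 hn]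
      rw [if_neg (show e 0 ≠ 1 by omega), if_neg (show e 0 ≠ 2 by omega), if_pos h1]
      simp [add_comm]
end counting

/-- Theorem (orbit-count formula, tuple form): the number of `s`-tuples of isometry classes of
nondegenerate quadratic forms of prescribed degrees `e i` whose orthogonal sum is Witt
equivalent to a fixed anisotropic form `Q₀` of degree `d`. -/
theorem statement_0 (p : ℕ) [Fact p.Prime] (hp : p ≠ 2) (K : Type) [Field K]
    [Algebra ℚ_[p] K] [FiniteDimensional ℚ_[p] K]
    (s : ℕ) (hs : 1 ≤ s) (e : Fin s → ℕ) (he : ∀ i, 1 ≤ e i)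
    (a b c : ℕ)
    (ha : a = (Finset.univ.filter (fun i => e i = 1)).card)
    (hb : b = (Finset.univ.filter (fun i => e i = 2)).card)
    (hc : c = (Finset.univ.filter (fun i => 3 ≤ e i)).card)
    (n : ℕ) (hn : n = ∑ i, e i)
    (d : ℕ) (Q₀ : QF K d) (hQ₀ : QuadraticMap.Anisotropic Q₀)
    (hdn : d ≤ n) (hpar : n % 2 = d % 2)
    (N : ℕ)
    (hN : N = Nat.card (Quot (fun
      (Qt Qt' : {Qt : ∀ i : Fin s, QF K (e i) //
        (∀ i, QNondeg (Qt i)) ∧ WittEquiv (QuadraticMap.pi (fun i => Qt i)) Q₀}) =>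
      ∀ i, QIsom (Qt.1 i) (Qt'.1 i)))) :
    (1 ≤ c → (8 : ℤ) * N = 4 ^ a * 7 ^ b * 8 ^ c) ∧
    (c = 0 → 0 < a → (8 : ℤ) * N = 4 ^ a * 7 ^ b + (2 - (d : ℤ)) * 2 ^ (a + 1)) ∧
    (a = 0 → c = 0 → (N : ℤ) = (7 ^ b - (-1 : ℤ) ^ b) / 8 +
      (if d = 0 ∧ Even b then (1 : ℤ) else if d = 4 ∧ Odd b then -1 else 0)) := by
  obtain ⟨u, t, f1, f2, f3⟩ := field_facts p hp K
  have h2 : (2 : K) ≠ 0 := by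
    intro h
    have h' : algebraMap ℚ_[p] K 2 = 0 := by rw [map_ofNat]; exact h
    rw [map_eq_zero_iff _ (algebraMap ℚ_[p] K).injective] at h'
    exact two_ne_zero h'
  obtain ⟨W, i1, i2, i3, dd, R, hC, hM⟩ := exists_model h2 u t f1 f2 f3
  obtain ⟨w₀, hw₀, hcard⟩ := card_quot hM (fun w => (hC.d0 w).mp) h2 e Q₀ hQ₀
  have key : (8 : ℤ) * N = GG a b c n d := by
    rw [hN, hcard, NN_eq, NN_formula hC e he, hw₀, ha, hb, hc, hn]
    simp only [Finset.card_filter]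
  rw [GG, if_pos hpar.symm] at key
  refine ⟨fun h => ?_, fun h h' => ?_, fun h h' => ?_⟩
  · rw [key, if_pos (show 0 < c from h), add_zero]
  · subst h
    rw [key, if_neg (lt_irrefl 0), if_pos h', pow_zero, mul_one]
  · subst h h'
    rw [if_neg (lt_irrefl 0), if_neg (lt_irrefl 0), pow_zero, pow_zero, one_mul, mul_one] at key
    rcases Nat.even_or_odd b with hbe | hbo
    · rw [hbe.neg_one_pow, Nat.even_iff.mp hbe, mul_zero] at key
      rw [hbe.neg_one_pow]
      have : ¬ Odd b := by simpa using hbe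
      simp only [hbe, this, and_true, and_false, if_false]
      split_ifs at key ⊢ <;> omega
    · rw [hbo.neg_one_pow, Nat.odd_iff.mp hbo, mul_one] at key
      rw [hbo.neg_one_pow]
      have : ¬ Even b := by simpa using hbo
      simp only [hbo, this, and_true, and_false, if_false]
      split_ifs at key ⊢ <;> omega
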